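/- Let d ≥ 1, λ ≥ 1, m ≥ 1, T ≥ 1 and δ ∈ (0,1). Under the delayed linear bandit model — θ ∈ ℝ^d with ‖θ‖₂ ≤ 1; delay distribution 𝓓 on ℕ with τ_m := P_{D∼𝓓}(D ≤ m) > 0; at each round t the learner is given a finite set 𝒜_t ⊂ ℝ^d with ‖a‖₂ ≤ 1 and ⟨a,θ⟩ ∈ [0,1] for all a ∈ 𝒜_t; conditionally on the past and A_t, X_t ∈ {0,1} is Bernoulli(⟨A_t,θ⟩) and D_t ∼ 𝓓 is independent of the past, A_t and X_t — suppose the learner plays OTFLinUCB, i.e. A_t ∈ 𝒜_t satisfies ⟨A_t, θ̂ᵂ_t⟩ + α_{t,δ}‖A_t‖_{V_t(λ)^{-1}} ≥ ⟨a, θ̂ᵂ_t⟩ + α_{t,δ}‖a‖_{V_t(λ)^{-1}} for all a ∈ 𝒜_t, where θ̂ᵂ_t = V_t(λ)^{-1} Σ_{s=1}^{t−1} X_s·1{D_s ≤ min(m,t−s)}·A_s and α_{t,δ} = 2 f_{t,δ} + Σ_{s=max(1,t−m)}^{t−1} ‖A_s‖_{V_t(λ)^{-1}}. Then with probability at least 1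 − 2δ the regret satisfies R(T,θ) = Σ_{t=1}^T (max_{a∈𝒜_t}⟨θ,a⟩ − ⟨θ,A_t⟩) ≤ (4 f_{T,δ}/τ_m)·√(2 d T log((dλ+T)/(dλ))) + (4 m d/τ_m)·log((dλ+T)/(dλ)). -/

import Mathlib

open Finset Matrix MeasureTheory ProbabilityTheory

/-- `mnorm M x = √(xᵀ M x)`, the norm associated to a positive definite matrix `M`. -/
noncomputable def mnorm {d : ℕ} (M : Matrix (Fin d) (Fin d) ℝ) (x : Fin d → ℝ) : ℝ :=
  Real.sqrt (x ⬝ᵥ M.mulVec x)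

/-- `Vmat A lam t = lam • I + ∑_{s=1}^{t-1} A_s A_sᵀ`. -/
noncomputable def Vmat {d : ℕ} (A : ℕ → Fin d → ℝ) (lam : ℝ) (t : ℕ) :
    Matrix (Fin d) (Fin d) ℝ :=
  lam • (1 : Matrix (Fin d) (Fin d) ℝ) + ∑ s ∈ Finset.Ico 1 t, vecMulVec (A s) (A s)

/-- Exploration radius `f_{t,δ} = √λ + √(2 log(1/δ) + d log((dλ + t)/(dλ)))`. -/
noncomputable def fconf (d : ℕ) (lam δ : ℝ) (t : ℕ) : ℝ :=
  Real.sqrt lam +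
    Real.sqrt (2 * Real.log (1 / δ) + d * Real.log ((d * lam + t) / (d * lam)))

/-- The σ-algebra generated by `A_1, X_1, D_1, …, A_{t-1}, X_{t-1}, D_{t-1}, A_t`. -/
def hist {Ω : Type*} {d : ℕ} (A : ℕ → Ω → Fin d → ℝ) (X : ℕ → Ω → ℝ)
    (D : ℕ → Ω → ℕ) (t : ℕ) : MeasurableSpace Ω :=
  (⨆ s ∈ Finset.Ico 1 t,
      (MeasurableSpace.comap (A s) inferInstance ⊔
        MeasurableSpace.comap (X s) inferInstance ⊔
          MeasurableSpace.comap (D s) inferInstance)) ⊔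
    MeasurableSpace.comap (A t) inferInstance

/-- The windowed least-squares estimator
`θ̂ᵂ_t = V_t(λ)⁻¹ ∑_{s=1}^{t-1} X_s · 1{D_s ≤ min(m, t-s)} · A_s`. -/
noncomputable def thetaHatW {Ω : Type*} {d : ℕ} (A : ℕ → Ω → Fin d → ℝ)
    (X : ℕ → Ω → ℝ) (D : ℕ → Ω → ℕ) (lam : ℝ) (m t : ℕ) (ω : Ω) : Fin d → ℝ :=
  (Vmat (fun s => A s ω) lam t)⁻¹.mulVec
    (∑ s ∈ Finset.Ico 1 t,
      (X s ω * (if D s ω ≤ min m (t - s) then (1 : ℝ) else 0)) • A s ω)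

/-- The OTFLinUCB confidence width
`α_{t,δ} = 2 f_{t,δ} + ∑_{s=max(1,t-m)}^{t-1} ‖A_s‖_{V_t(λ)⁻¹}`. -/
noncomputable def ucbWidth {Ω : Type*} {d : ℕ} (A : ℕ → Ω → Fin d → ℝ)
    (lam δ : ℝ) (m t : ℕ) (ω : Ω) : ℝ :=
  2 * fconf d lam δ t +
    ∑ s ∈ Finset.Ico (max 1 (t - m)) t,
      mnorm (Vmat (fun u => A u ω) lam t)⁻¹ (A s ω)

noncomputable def Qf {d : ℕ} (A : ℕ → Fin d → ℝ) (lam : ℝ) (t : ℕ) (x y : Fin d → ℝ) : ℝ :=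
  x ⬝ᵥ (Vmat A lam t)⁻¹.mulVec y

section linalg
variable {d : ℕ} {A : ℕ → Fin d → ℝ} {lam : ℝ}

lemma Vmat_posDef (hl : 0 < lam) (t : ℕ) : (Vmat A lam t).PosDef := by
  unfold Vmat
  refine Matrix.PosDef.add_posSemidef (Matrix.PosDef.one.smul hl) ?_
  refine Matrix.posSemidef_sum _ fun i _ => ?_
  simpa using Matrix.posSemidef_vecMulVec_self_star (A i)

lemma Vmat_unit (hl : 0 < lam) (t : ℕ) : IsUnit (Vmat A lam t).det :=
  (Vmat_posDef hl t).det_pos.ne'.isUnit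

lemma Vmat_succ {t : ℕ} (ht : 1 ≤ t) :
    Vmat A lam (t+1) = Vmat A lam t + vecMulVec (A t) (A t) := by
  unfold Vmat
  rw [Finset.sum_Ico_succ_top ht, add_assoc]

lemma Qf_add_right (t : ℕ) (x y z : Fin d → ℝ) :
    Qf A lam t x (y + z) = Qf A lam t x y + Qf A lam t x z := by
  simp [Qf, mulVec_add]

lemma Qf_smul_right (t : ℕ) (c : ℝ) (x y : Fin d → ℝ) :
    Qf A lam t x (c • y) = c * Qf A lam t x y := by
  simp [Qf, mulVec_smul]

lemma Qf_symm (hl : 0 < lam) (t : ℕ) (x y : Fin d → ℝ) :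
    Qf A lam t x y = Qf A lam t y x := by
  unfold Qf
  have h : ((Vmat A lam t)⁻¹)ᵀ = (Vmat A lam t)⁻¹ := by
    simpa using (Vmat_posDef (A := A) hl t).inv.isHermitian.eq
  rw [dotProduct_mulVec, ← mulVec_transpose, h, dotProduct_comm]

lemma Qf_add_left (hl : 0 < lam) (t : ℕ) (x y z : Fin d → ℝ) :
    Qf A lam t (y + z) x = Qf A lam t y x + Qf A lam t z x := by
  simp [Qf]

lemma Qf_smul_left (t : ℕ) (c : ℝ) (x y : Fin d → ℝ) :
    Qf A lam t (c • x) y = c * Qf A lam t x y := by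
  simp [Qf]

lemma Qf_sum_right {ι : Type*} (t : ℕ) (x : Fin d → ℝ) (s : Finset ι) (f : ι → Fin d → ℝ) :
    Qf A lam t x (∑ i ∈ s, f i) = ∑ i ∈ s, Qf A lam t x (f i) := by
  classical
  induction s using Finset.induction_on with
  | empty => simp [Qf]
  | insert a s ha ih => rw [Finset.sum_insert ha, Finset.sum_insert ha, Qf_add_right, ih]

lemma Qf_nonneg (hl : 0 < lam) (t : ℕ) (x : Fin d → ℝ) : 0 ≤ Qf A lam t x x := by
  simpa [Qf] using (Vmat_posDef (A := A) hl t).inv.posSemidef.dotProduct_mulVec_nonneg x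

lemma Qf_cs (hl : 0 < lam) (t : ℕ) (x y : Fin d → ℝ) :
    |Qf A lam t x y| ≤ √(Qf A lam t x x) * √(Qf A lam t y y) := by
  rw [← Real.sqrt_mul (Qf_nonneg hl t x)]
  apply Real.abs_le_sqrt
  have h : ∀ r : ℝ, 0 ≤ Qf A lam t y y * (r * r) + (2 * Qf A lam t x y) * r + Qf A lam t x x := by
    intro r
    have := Qf_nonneg (A := A) hl t (x + r • y)
    rw [Qf_add_left hl, Qf_add_right, Qf_add_right, Qf_smul_left, Qf_smul_left, Qf_smul_right,
      Qf_smul_right, Qf_symm hl t y x] at this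
    linarith
  have := discrim_le_zero h
  unfold discrim at this
  nlinarith

lemma Qf_succ (hl : 0 < lam) {t : ℕ} (ht : 1 ≤ t) (x y : Fin d → ℝ) :
    Qf A lam (t+1) x y = Qf A lam t x y -
      Qf A lam t x (A t) * Qf A lam t (A t) y / (1 + Qf A lam t (A t) (A t)) := by
  have hw := Qf_nonneg (A := A) hl t (A t)
  have hU := Vmat_unit (A := A) hl t
  have hU' := Vmat_unit (A := A) hl (t+1)
  have key : (Vmat A lam (t+1)).mulVec ((Vmat A lam t)⁻¹.mulVec y -
      (Qf A lam t (A t) y / (1 + Qf A lam t (A t) (A t))) • (Vmat A lam t)⁻¹.mulVec (A t)) = y := by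
    rw [Vmat_succ ht, add_mulVec, mulVec_sub, mulVec_sub, mulVec_smul, mulVec_smul, mulVec_mulVec,
      mulVec_mulVec, Matrix.mul_nonsing_inv _ hU, one_mulVec, one_mulVec, vecMulVec_mulVec,
      vecMulVec_mulVec]
    change y - _ + (MulOpposite.op (Qf A lam t (A t) y) • A t -
      _ • MulOpposite.op (Qf A lam t (A t) (A t)) • A t) = y
    ext i
    simp
    field_simp
    ring
  have : (Vmat A lam (t+1))⁻¹.mulVec y = ((Vmat A lam t)⁻¹.mulVec y -
      (Qf A lam t (A t) y / (1 + Qf A lam t (A t) (A t))) • (Vmat A lam t)⁻¹.mulVec (A t)) := by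
    conv_lhs => rw [← key]
    rw [mulVec_mulVec, Matrix.nonsing_inv_mul _ hU', one_mulVec]
  conv_lhs => rw [Qf, this]
  rw [dotProduct_sub, dotProduct_smul]
  change Qf A lam t x y - _ • Qf A lam t x (A t) = _
  rw [smul_eq_mul]
  ring

lemma det_succ (hl : 0 < lam) {t : ℕ} (ht : 1 ≤ t) :
    (Vmat A lam (t+1)).det = (Vmat A lam t).det * (1 + Qf A lam t (A t) (A t)) := by
  rw [Vmat_succ ht, vecMulVec_eq Unit, det_add_replicateCol_mul_replicateRow (Vmat_unit hl t)]
  congr 1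
  rw [Matrix.det_unique]
  simp only [Matrix.add_apply, Matrix.one_apply_eq]
  congr 1
  rw [Matrix.mul_assoc]
  rfl

lemma Vmat_one : Vmat A lam 1 = lam • (1 : Matrix (Fin d) (Fin d) ℝ) := by
  simp [Vmat]

lemma Qf_one (hl : 0 < lam) (x : Fin d → ℝ) : Qf A lam 1 x x = x ⬝ᵥ x / lam := by
  have : (lam • (1 : Matrix (Fin d) (Fin d) ℝ))⁻¹ = lam⁻¹ • (1 : Matrix (Fin d) (Fin d) ℝ) := by
    apply Matrix.inv_eq_right_inv
    simp [smul_smul, hl.ne']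
  rw [Qf, Vmat_one, this, smul_mulVec, one_mulVec, dotProduct_smul, smul_eq_mul]
  ring

lemma Qf_anti_succ (hl : 0 < lam) {t : ℕ} (ht : 1 ≤ t) (x : Fin d → ℝ) :
    Qf A lam (t+1) x x ≤ Qf A lam t x x := by
  rw [Qf_succ hl ht, Qf_symm hl t (A t) x]
  have : 0 ≤ Qf A lam t x (A t) * Qf A lam t x (A t) / (1 + Qf A lam t (A t) (A t)) :=
    div_nonneg (mul_self_nonneg _) (by linarith [Qf_nonneg (A := A) hl t (A t)])
  linarith

lemma Qf_anti (hl : 0 < lam) {s t : ℕ} (hs : 1 ≤ s) (hst : s ≤ t) (x : Fin d → ℝ) :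
    Qf A lam t x x ≤ Qf A lam s x x := by
  induction t, hst using Nat.le_induction with
  | base => rfl
  | succ n hn ih => exact (Qf_anti_succ hl (hs.trans hn) x).trans ih

lemma Qf_le (hl : 0 < lam) {t : ℕ} (ht : 1 ≤ t) (x : Fin d → ℝ) :
    Qf A lam t x x ≤ x ⬝ᵥ x / lam :=
  (Qf_anti hl le_rfl ht x).trans (Qf_one hl x).le

lemma log_det_le (hd : 1 ≤ d) (hl : 0 < lam) {t : ℕ}
    (hA : ∀ s ∈ Finset.Icc 1 t, A s ⬝ᵥ A s ≤ 1) :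
    Real.log (Vmat A lam (t+1)).det - d * Real.log lam ≤
      d * Real.log ((d * lam + t) / (d * lam)) := by
  have hP := Vmat_posDef (A := A) hl (t+1)
  have hd' : (0:ℝ) < d := by exact_mod_cast hd
  have htr : (Vmat A lam (t+1)).trace ≤ d * lam + t := by
    unfold Vmat
    rw [trace_add, trace_smul, trace_one, trace_sum]
    simp only [trace_vecMulVec, Fintype.card_fin, smul_eq_mul]
    have : ∑ s ∈ Finset.Ico 1 (t+1), A s ⬝ᵥ A s ≤ ∑ s ∈ Finset.Ico 1 (t+1), (1:ℝ) :=
      Finset.sum_le_sum fun s hs => hA s (by simp at hs ⊢; omega)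
    simp at this
    linarith
  have hdet := hP.isHermitian.det_eq_prod_eigenvalues
  have htr2 := hP.isHermitian.trace_eq_sum_eigenvalues
  simp only [RCLike.ofReal_real_eq_id, id] at hdet htr2
  have hpos := hP.eigenvalues_pos
  rw [hdet, Real.log_prod (fun i _ => (hpos i).ne')]
  have hi : ∀ i, Real.log (hP.isHermitian.eigenvalues i) ≤
      Real.log ((d * lam + t) / d) + hP.isHermitian.eigenvalues i / ((d * lam + t) / d) - 1 := by
    intro i
    have hc : 0 < (d * lam + t) / d := by positivity
    have := Real.log_le_sub_one_of_pos (div_pos (hpos i) hc)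
    rw [Real.log_div (hpos i).ne' hc.ne'] at this
    linarith
  have hs := Finset.sum_le_sum (s := Finset.univ) fun i _ => hi i
  rw [Finset.sum_sub_distrib, Finset.sum_add_distrib, ← Finset.sum_div, ← htr2] at hs
  simp only [Finset.sum_const, Finset.card_univ, Fintype.card_fin, nsmul_eq_mul] at hs
  have h3 : (Vmat A lam (t+1)).trace / ((d * lam + t) / d) ≤ d := by
    rw [div_le_iff₀ (by positivity)]
    calc _ ≤ _ := htr
      _ = _ := by field_simp
  have h4 : Real.log ((d * lam + t) / (d * lam)) = Real.log ((d * lam + t) / d) - Real.log lam := by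
    rw [← Real.log_div (by positivity) hl.ne', div_div]
  rw [h4]
  linarith

lemma log_ratio_mono (hd : 1 ≤ d) (hl : 0 < lam) {s t : ℕ} (h : s ≤ t) :
    d * Real.log ((d * lam + s) / (d * lam)) ≤ d * Real.log ((d * lam + t) / (d * lam)) := by
  have hd' : (0:ℝ) < d := by exact_mod_cast hd
  gcongr

lemma log_ratio_nonneg (hd : 1 ≤ d) (hl : 0 < lam) (t : ℕ) :
    0 ≤ d * Real.log ((d * lam + t) / (d * lam)) := by
  have hd' : (0:ℝ) < d := by exact_mod_cast hd
  refine mul_nonneg hd'.le (Real.log_nonneg ?_)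
  rw [le_div_iff₀ (by positivity)]
  linarith [(Nat.cast_nonneg t : (0:ℝ) ≤ t)]

lemma sum_Qf_le (hd : 1 ≤ d) (hl : 1 ≤ lam) {t : ℕ}
    (hA : ∀ s ∈ Finset.Icc 1 t, A s ⬝ᵥ A s ≤ 1) :
    ∑ s ∈ Finset.Icc 1 t, Qf A lam s (A s) (A s) ≤
      2 * (d * Real.log ((d * lam + t) / (d * lam))) := by
  have hl0 : 0 < lam := by linarith
  refine le_trans ?_ (mul_le_mul_of_nonneg_left (log_det_le hd hl0 hA) zero_le_two)
  have : ∀ n ≤ t, ∑ s ∈ Finset.Icc 1 n, Qf A lam s (A s) (A s) ≤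
      2 * (Real.log (Vmat A lam (n+1)).det - d * Real.log lam) := by
    intro n
    induction n with
    | zero => intro _; simp [Vmat_one]
    | succ n ih =>
      intro hn
      rw [Finset.sum_Icc_succ_top (by omega), det_succ hl0 (by omega)]
      have h0 := Qf_nonneg (A := A) hl0 (n+1) (A (n+1))
      have h1 : Qf A lam (n+1) (A (n+1)) (A (n+1)) ≤ 1 := by
        refine (Qf_le hl0 (by omega) _).trans ?_
        rw [div_le_one hl0]
        exact (hA _ (by simp; omega)).trans hl
      rw [Real.log_mul (Vmat_posDef hl0 _).det_pos.ne' (by linarith)]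
      have h2 := Real.le_log_one_add_of_nonneg h0
      have h3 : Qf A lam (n+1) (A (n+1)) (A (n+1)) / 2 ≤
        2 * Qf A lam (n+1) (A (n+1)) (A (n+1)) / (Qf A lam (n+1) (A (n+1)) (A (n+1)) + 2) := by
        rw [div_le_div_iff₀ (by norm_num) (by linarith)]
        nlinarith
      have := ih (by omega)
      linarith
  exact this t le_rfl

end linalg
noncomputable def Sv {d : ℕ} (A : ℕ → Fin d → ℝ) (η : ℕ → ℝ) (t : ℕ) : Fin d → ℝ :=
  ∑ s ∈ Finset.Ico 1 t, η s • A s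

noncomputable def Mp {d : ℕ} (A : ℕ → Fin d → ℝ) (lam : ℝ) (η : ℕ → ℝ) (t : ℕ) : ℝ :=
  Real.exp ((Qf A lam t (Sv A η t) (Sv A η t) -
    (Real.log (Vmat A lam t).det - d * Real.log lam)) / 2)

noncomputable def Hp {d : ℕ} (A : ℕ → Fin d → ℝ) (lam : ℝ) (η : ℕ → ℝ) (t : ℕ) : ℝ :=
  Real.tanh (Qf A lam t (A t) (Sv A η t) / (1 + Qf A lam t (A t) (A t)))

lemma exp_le_tanh {η x : ℝ} (hη : |η| ≤ 1) :
    Real.exp (η * x - x ^ 2 / 2) ≤ 1 + η * Real.tanh x := by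
  obtain ⟨h1, h2⟩ := abs_le.1 hη
  have hc := convexOn_exp.2 (Set.mem_univ x) (Set.mem_univ (-x))
    (show 0 ≤ (1 + η) / 2 by linarith) (show 0 ≤ (1 - η) / 2 by linarith) (by ring)
  simp only [smul_eq_mul] at hc
  have e1 : (1 + η) / 2 * x + (1 - η) / 2 * (-x) = η * x := by ring
  rw [e1] at hc
  have hcosh := Real.cosh_pos x
  have e2 : (1 + η) / 2 * Real.exp x + (1 - η) / 2 * Real.exp (-x) =
      Real.cosh x * (1 + η * Real.tanh x) := by
    rw [Real.tanh_eq_sinh_div_cosh]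
    field_simp
    rw [Real.cosh_eq, Real.sinh_eq]
    ring
  rw [e2] at hc
  have ht : 0 ≤ 1 + η * Real.tanh x := by
    have : |η * Real.tanh x| ≤ 1 := by
      rw [abs_mul]
      exact mul_le_one₀ hη (abs_nonneg _) (Real.abs_tanh_lt_one x).le
    linarith [(abs_le.1 this).1]
  rw [Real.exp_sub, div_le_iff₀ (Real.exp_pos _)]
  calc _ ≤ _ := hc
    _ ≤ Real.exp (x ^ 2 / 2) * (1 + η * Real.tanh x) :=
      mul_le_mul_of_nonneg_right (Real.cosh_le_exp_half_sq x) ht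
    _ = _ := mul_comm _ _

lemma Mp_succ {d : ℕ} {A : ℕ → Fin d → ℝ} {lam : ℝ} (hl : 0 < lam) {η : ℕ → ℝ} {t : ℕ}
    (ht : 1 ≤ t) (hη : |η t| ≤ 1) :
    Mp A lam η (t+1) ≤ Mp A lam η t * (1 + η t * Hp A lam η t) := by
  have hS : Sv A η (t+1) = Sv A η t + η t • A t := by
    unfold Sv; rw [Finset.sum_Ico_succ_top ht]
  have hw := Qf_nonneg (A := A) hl t (A t)
  unfold Hp
  refine le_trans ?_ (mul_le_mul_of_nonneg_left (exp_le_tanh hη) (Real.exp_pos _).le)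
  unfold Mp
  rw [← Real.exp_add, Real.exp_le_exp, det_succ hl ht,
    Real.log_mul (Vmat_posDef hl _).det_pos.ne' (by linarith), Qf_succ hl ht, hS]
  simp only [Qf_add_left hl, Qf_add_right, Qf_smul_left, Qf_smul_right]
  rw [Qf_symm hl t (Sv A η t) (A t)]
  set w := Qf A lam t (A t) (A t)
  set u := Qf A lam t (A t) (Sv A η t)
  set q := Qf A lam t (Sv A η t) (Sv A η t)
  have hlog : 1 - (1 + w)⁻¹ ≤ Real.log (1 + w) :=
    Real.one_sub_inv_le_log_of_pos (by linarith)
  have h1 : η t ^ 2 * (w / (1 + w)) ≤ Real.log (1 + w) := by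
    have e : 1 - (1 + w)⁻¹ = w / (1 + w) := by field_simp; ring
    rw [e] at hlog
    have : η t ^ 2 ≤ 1 := by rw [sq_le_one_iff_abs_le_one]; exact hη
    have h0 : 0 ≤ w / (1 + w) := by positivity
    nlinarith
  have h2 : (u / (1 + w)) ^ 2 ≤ u ^ 2 / (1 + w) := by
    rw [div_pow]
    apply div_le_div_of_nonneg_left (sq_nonneg _) (by linarith)
    nlinarith
  have h3 : q + η t * u + (η t * u + η t * (η t * w)) -
      (u + η t * w) * (u + η t * w) / (1 + w) =
      q + (2 * (η t * (u / (1 + w))) + η t ^ 2 * (w / (1 + w)) - u ^ 2 / (1 + w)) := by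
    field_simp
    ring
  have h3' : q + η t * u + η t * (u + η t * w) -
      (u + η t * w) * (u + η t * w) / (1 + w) =
      q + (2 * (η t * (u / (1 + w))) + η t ^ 2 * (w / (1 + w)) - u ^ 2 / (1 + w)) := by
    rw [← h3]; ring
  linarith

lemma Mp_one {d : ℕ} {A : ℕ → Fin d → ℝ} {lam : ℝ} {η : ℕ → ℝ} :
    Mp A lam η 1 = 1 := by
  simp [Mp, Sv, Vmat_one, Qf]

section meas
variable {α : Type*} [MeasurableSpace α] {d : ℕ}

lemma meas_det {n : ℕ} {W : α → Matrix (Fin n) (Fin n) ℝ} (h : ∀ i j, Measurable fun a => W a i j) :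
    Measurable fun a => (W a).det := by
  simp only [det_apply]
  refine Finset.measurable_sum _ fun σ _ => ?_
  refine Measurable.const_smul (Finset.measurable_prod _ fun i _ => h _ _) _

lemma meas_inv {W : α → Matrix (Fin d) (Fin d) ℝ} (h : ∀ i j, Measurable fun a => W a i j)
    (i j : Fin d) : Measurable fun a => (W a)⁻¹ i j := by
  simp only [Matrix.inv_def, Matrix.smul_apply, adjugate_apply, Ring.inverse_eq_inv, smul_eq_mul]
  refine (meas_det h).inv.mul (meas_det fun k l => ?_)
  simp only [Matrix.updateRow_apply]
  split_ifs
  · exact measurable_const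
  · exact h _ _

lemma meas_V {A : ℕ → α → Fin d → ℝ} {t : ℕ} (h : ∀ s ∈ Finset.Ico 1 t, Measurable (A s))
    (lam : ℝ) (i j : Fin d) : Measurable fun a => Vmat (fun s => A s a) lam t i j := by
  simp only [Vmat, Matrix.add_apply, Matrix.sum_apply, vecMulVec_apply]
  refine measurable_const.add (Finset.measurable_sum _ fun s hs => ?_)
  exact ((measurable_pi_apply i).comp (h s hs)).mul ((measurable_pi_apply j).comp (h s hs))

lemma meas_Qf {A : ℕ → α → Fin d → ℝ} {t : ℕ} (h : ∀ s ∈ Finset.Ico 1 t, Measurable (A s))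
    (lam : ℝ) {x y : α → Fin d → ℝ} (hx : Measurable x) (hy : Measurable y) :
    Measurable fun a => Qf (fun s => A s a) lam t (x a) (y a) := by
  simp only [Qf, dotProduct, mulVec]
  refine Finset.measurable_sum _ fun i _ => ((measurable_pi_apply i).comp hx).mul ?_
  refine Finset.measurable_sum _ fun j _ => ?_
  exact (meas_inv (meas_V h lam) i j).mul ((measurable_pi_apply j).comp hy)

lemma meas_Sv {A : ℕ → α → Fin d → ℝ} {η : ℕ → α → ℝ} {t : ℕ}
    (h : ∀ s ∈ Finset.Ico 1 t, Measurable (A s)) (hη : ∀ s ∈ Finset.Ico 1 t, Measurable (η s)) :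
    Measurable fun a => Sv (fun s => A s a) (fun s => η s a) t := by
  unfold Sv
  exact Finset.measurable_sum _ fun s hs => (hη s hs).smul (h s hs)

lemma meas_Mp {A : ℕ → α → Fin d → ℝ} {η : ℕ → α → ℝ} {t : ℕ}
    (h : ∀ s ∈ Finset.Ico 1 t, Measurable (A s)) (hη : ∀ s ∈ Finset.Ico 1 t, Measurable (η s))
    (lam : ℝ) :
    Measurable fun a => Mp (fun s => A s a) lam (fun s => η s a) t := by
  unfold Mp
  refine Real.measurable_exp.comp (Measurable.div_const (Measurable.sub ?_ ?_) _)
  · exact meas_Qf h lam (meas_Sv h hη) (meas_Sv h hη)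
  · exact (Real.measurable_log.comp (meas_det (meas_V h lam))).sub measurable_const

lemma meas_Hp {A : ℕ → α → Fin d → ℝ} {η : ℕ → α → ℝ} {t : ℕ}
    (h : ∀ s ∈ Finset.Ico 1 t, Measurable (A s)) (hη : ∀ s ∈ Finset.Ico 1 t, Measurable (η s))
    (ht : Measurable (A t)) (lam : ℝ) :
    Measurable fun a => Hp (fun s => A s a) lam (fun s => η s a) t := by
  unfold Hp
  have : Measurable Real.tanh := by
    have : Real.tanh = fun x => Real.sinh x / Real.cosh x := by
      ext x; exact Real.tanh_eq_sinh_div_cosh x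
    rw [this]
    exact Real.measurable_sinh.div Real.measurable_cosh
  refine this.comp (Measurable.div ?_ (measurable_const.add ?_))
  · exact meas_Qf h lam ht (meas_Sv h hη)
  · exact meas_Qf h lam ht ht

end meas

lemma ville {Ω : Type*} [m0 : MeasurableSpace Ω] (P : Measure Ω) [IsProbabilityMeasure P]
    (F : ℕ → MeasurableSpace Ω) (hF : ∀ t, F t ≤ m0) (hFm : ∀ t, 1 ≤ t → F t ≤ F (t+1))
    (M : ℕ → Ω → ℝ) (T : ℕ) (hM : ∀ t, 1 ≤ t → Measurable[F t] (M t)) (hM0 : ∀ t ω, 0 ≤ M t ω)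
    (hMi : ∀ t ∈ Finset.Icc 1 T, Integrable (M t) P) (hM1 : ∀ ω, M 1 ω = 1)
    (hstep : ∀ t, 1 ≤ t → t < T → ∀ G, MeasurableSet[F t] G →
      ∫ ω in G, M (t+1) ω ∂P ≤ ∫ ω in G, M t ω ∂P)
    (c : ℝ) (hc : 1 ≤ c) (hT : 1 ≤ T) :
    c * P.real {ω | ∃ t ∈ Finset.Icc 1 T, c < M t ω} ≤ 1 := by
  set C : ℕ → Set Ω := fun n => {ω | ∃ t ∈ Finset.Icc 1 n, c < M t ω} with hC
  have hB : ∀ n, 1 ≤ n → MeasurableSet[F n] {ω | c < M n ω} := fun n hn =>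
    hM n hn measurableSet_Ioi
  have hCs : ∀ n, C (n+1) = C n ∪ {ω | c < M (n+1) ω} := by
    intro n
    ext ω
    simp only [hC, Set.mem_ofPred_eq, Set.mem_union, Finset.mem_Icc]
    constructor
    · rintro ⟨t, ht, h⟩
      by_cases h' : t = n + 1
      · subst h'; exact Or.inr h
      · exact Or.inl ⟨t, by omega, h⟩
    · rintro (⟨t, ht, h⟩ | h)
      · exact ⟨t, by omega, h⟩
      · exact ⟨n+1, by omega, h⟩
  have hC0 : C 0 = ∅ := by ext ω; simp [hC]
  have hC1 : C 1 = ∅ := by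
    rw [hCs 0, hC0]; ext ω; simp [hM1, hc]
  have hCm : ∀ n, 1 ≤ n → MeasurableSet[F n] (C n) := by
    intro n hn
    induction n, hn using Nat.le_induction with
    | base => rw [hC1]; exact @MeasurableSet.empty _ (F 1)
    | succ n hn ih =>
      rw [hCs]
      exact @MeasurableSet.union _ (F (n+1)) _ _ (hFm n hn _ ih) (hB (n+1) (by omega))
  have key : ∀ n, 1 ≤ n → n ≤ T → c * P.real (C n) + ∫ ω in (C n)ᶜ, M n ω ∂P ≤ 1 := by
    intro n hn
    induction n, hn using Nat.le_induction with
    | base => intro _; simp [hC1, hM1]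
    | succ n hn ih =>
      intro hnT
      have ih := ih (by omega)
      have hst := hstep n hn (by omega) (C n)ᶜ (@MeasurableSet.compl _ _ (F n) (hCm n hn))
      have hBm := hF _ _ (hB (n+1) (by omega))
      have hCn := hF _ _ (hCm n hn)
      have hi := hMi (n+1) (by simp; omega)
      have hsplit : (C n)ᶜ = ((C n)ᶜ ∩ {ω | c < M (n+1) ω}) ∪ (C (n+1))ᶜ := by
        rw [hCs]; ext ω; simp only [Set.mem_union, Set.mem_inter_iff, Set.mem_compl_iff]; tauto
      have hdis : Disjoint ((C n)ᶜ ∩ {ω | c < M (n+1) ω}) (C (n+1))ᶜ := by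
        rw [hCs, Set.disjoint_left]; intro ω
        simp only [Set.mem_union, Set.mem_inter_iff, Set.mem_compl_iff]; tauto
      have hint : ∫ ω in (C n)ᶜ, M (n+1) ω ∂P =
          ∫ ω in (C n)ᶜ ∩ {ω | c < M (n+1) ω}, M (n+1) ω ∂P + ∫ ω in (C (n+1))ᶜ, M (n+1) ω ∂P := by
        conv_lhs => rw [hsplit]
        exact setIntegral_union hdis (hF _ _ (hCm (n+1) (by omega))).compl hi.integrableOn
          hi.integrableOn
      have hlow : c * P.real ((C n)ᶜ ∩ {ω | c < M (n+1) ω}) ≤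
          ∫ ω in (C n)ᶜ ∩ {ω | c < M (n+1) ω}, M (n+1) ω ∂P := by
        have := setIntegral_mono_on (μ := P) (s := (C n)ᶜ ∩ {ω | c < M (n+1) ω}) (f := fun _ => c)
          (g := M (n+1)) (integrable_const _).integrableOn hi.integrableOn (hCn.compl.inter hBm)
          (fun ω hω => le_of_lt hω.2)
        simpa [mul_comm] using this
      have hP : P.real (C (n+1)) = P.real (C n) + P.real ((C n)ᶜ ∩ {ω | c < M (n+1) ω}) := by
        rw [← measureReal_union _ (hCn.compl.inter hBm)]
        · congr 1
          rw [hCs]; ext ω; simp only [Set.mem_union, Set.mem_inter_iff, Set.mem_compl_iff]; tauto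
        · rw [Set.disjoint_left]; intro ω h h'; exact h'.1 h
      rw [hP]
      linarith
  have := key T hT le_rfl
  have h0 : 0 ≤ ∫ ω in (C T)ᶜ, M T ω ∂P := integral_nonneg fun ω => hM0 T ω
  linarith
section histsec
variable {Ω : Type*} {d : ℕ} {A : ℕ → Ω → Fin d → ℝ} {X : ℕ → Ω → ℝ} {D : ℕ → Ω → ℕ}

lemma hist_le [m0 : MeasurableSpace Ω] (hA : ∀ t, Measurable (A t)) (hX : ∀ t, Measurable (X t))
    (hD : ∀ t, Measurable (D t)) (t : ℕ) : hist A X D t ≤ m0 := by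
  unfold hist
  refine sup_le (iSup₂_le fun s _ => sup_le (sup_le ?_ ?_) ?_) ?_
  · exact (hA s).comap_le
  · exact (hX s).comap_le
  · exact (hD s).comap_le
  · exact (hA t).comap_le

lemma hist_past {s t : ℕ} (hs : s ∈ Finset.Ico 1 t) :
    MeasurableSpace.comap (A s) inferInstance ⊔
        MeasurableSpace.comap (X s) inferInstance ⊔
          MeasurableSpace.comap (D s) inferInstance ≤ hist A X D t := by
  unfold hist
  exact le_sup_of_le_left (le_iSup₂_of_le s hs le_rfl)

lemma hist_mono {t : ℕ} (ht : 1 ≤ t) : hist A X D t ≤ hist A X D (t+1) := by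
  conv_lhs => unfold hist
  refine sup_le (iSup₂_le fun s hs => hist_past ?_) ?_
  · simp at hs ⊢; omega
  · refine le_trans ?_ (hist_past (s := t) (by simp; omega))
    exact le_sup_of_le_left le_sup_left

lemma hist_A {t : ℕ} : Measurable[hist A X D t] (A t) :=
  Measurable.of_comap_le (by unfold hist; exact le_sup_right)

lemma hist_As {s t : ℕ} (hs : s ∈ Finset.Ico 1 t) : Measurable[hist A X D t] (A s) :=
  Measurable.of_comap_le ((le_sup_of_le_left le_sup_left).trans (hist_past hs))

lemma hist_Xs {s t : ℕ} (hs : s ∈ Finset.Ico 1 t) : Measurable[hist A X D t] (X s) :=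
  Measurable.of_comap_le ((le_sup_of_le_left le_sup_right).trans (hist_past hs))

lemma hist_Ds {s t : ℕ} (hs : s ∈ Finset.Ico 1 t) : Measurable[hist A X D t] (D s) :=
  Measurable.of_comap_le (le_sup_right.trans (hist_past hs))

end histsec

noncomputable def etaN {Ω : Type*} {d : ℕ} (A : ℕ → Ω → Fin d → ℝ) (X : ℕ → Ω → ℝ)
    (D : ℕ → Ω → ℕ) (m : ℕ) (τ : ℝ) (θ : Fin d → ℝ) (s : ℕ) (ω : Ω) : ℝ :=
  X s ω * (if D s ω ≤ m then (1 : ℝ) else 0) - τ * (A s ω ⬝ᵥ θ)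

lemma meas_dot {Ω : Type*} [MeasurableSpace Ω] {d : ℕ} {a : Ω → Fin d → ℝ} (h : Measurable a)
    (θ : Fin d → ℝ) : Measurable fun ω => a ω ⬝ᵥ θ := by
  simp only [dotProduct]
  exact Finset.measurable_sum _ fun i _ => ((measurable_pi_apply i).comp h).mul measurable_const

lemma meas_etaN {Ω : Type*} [MeasurableSpace Ω] {d : ℕ} {A : ℕ → Ω → Fin d → ℝ} {X : ℕ → Ω → ℝ}
    {D : ℕ → Ω → ℕ} (m : ℕ) (τ : ℝ) (θ : Fin d → ℝ) (s : ℕ) (hA : Measurable (A s))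
    (hX : Measurable (X s)) (hD : Measurable (D s)) : Measurable (etaN A X D m τ θ s) := by
  unfold etaN
  refine (hX.mul ?_).sub (measurable_const.mul (meas_dot hA θ))
  exact Measurable.ite (hD (measurableSet_Iic (a := m))) measurable_const measurable_const

lemma noise_zero {Ω : Type*} {Hs : MeasurableSpace Ω} [m0 : MeasurableSpace Ω] (P : Measure Ω)
    [IsProbabilityMeasure P] (hHs : Hs ≤ m0) {X : Ω → ℝ} {D : Ω → ℕ} {p : Ω → ℝ} {m : ℕ}
    {𝓓 : Measure ℕ}
    (hX : Measurable X) (hD : Measurable D)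
    (hX01 : ∀ᵐ ω ∂P, X ω = 0 ∨ X ω = 1)
    (hXcond : P[X | Hs] =ᵐ[P] p) (hDlaw : Measure.map D P = 𝓓)
    (hDindep : Indep (MeasurableSpace.comap D inferInstance)
        (Hs ⊔ MeasurableSpace.comap X inferInstance) P)
    (h : Ω → ℝ) (hh : Measurable[Hs] h) (hi : Integrable h P) :
    ∫ ω, h ω * (X ω * (if D ω ≤ m then (1 : ℝ) else 0)
      - (𝓓 {n | n ≤ m}).toReal * p ω) ∂P = 0 := by
  have hXb : ∀ᵐ ω ∂P, ‖X ω‖ ≤ 1 := by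
    filter_upwards [hX01] with ω hω
    rcases hω with h | h <;> simp [h]
  have hXi : Integrable X P :=
    Integrable.mono' (integrable_const (1:ℝ)) hX.aestronglyMeasurable hXb
  have hhX : Integrable (h * X) P := by
    have := hi.bdd_mul (c := 1) hX.aestronglyMeasurable hXb
    exact this.congr (Filter.Eventually.of_forall fun ω => mul_comm _ _)
  set c : Ω → ℝ := fun ω => if D ω ≤ m then (1 : ℝ) else 0 with hc
  have hcm : Measurable c :=
    Measurable.ite (hD (measurableSet_Iic (a := m))) measurable_const measurable_const
  have hce : ∫ ω, c ω ∂P = (𝓓 {n | n ≤ m}).toReal := by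
    have : c = (D ⁻¹' {n | n ≤ m}).indicator 1 := by
      ext ω; simp [hc, Set.indicator]
    have hms : MeasurableSet {n : ℕ | n ≤ m} := measurableSet_Iic
    rw [this, integral_indicator_one (hD hms), ← hDlaw, Measure.map_apply hD hms]
    rfl
  have hind : IndepFun c (h * X) P := by
    refine indep_of_indep_of_le_left (indep_of_indep_of_le_right hDindep ?_) ?_
    · have h1 : Measurable[Hs ⊔ MeasurableSpace.comap X inferInstance] h :=
        hh.mono le_sup_left le_rfl
      have h2 : Measurable[Hs ⊔ MeasurableSpace.comap X inferInstance] X :=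
        Measurable.of_comap_le le_sup_right
      have h3 : Measurable[Hs ⊔ MeasurableSpace.comap X inferInstance] (h * X) :=
        Measurable.mul h1 h2
      exact h3.comap_le
    · have : Measurable[MeasurableSpace.comap D inferInstance] c := by
        have h0 : Measurable (fun n : ℕ => if n ≤ m then (1:ℝ) else 0) := measurable_of_countable _
        exact h0.comp (comap_measurable D)
      exact this.comap_le
  have e1 : ∫ ω, c ω * (h ω * X ω) ∂P = (𝓓 {n | n ≤ m}).toReal * ∫ ω, h ω * X ω ∂P := by
    rw [← hce]
    exact hind.integral_fun_mul_eq_mul_integral hcm.aestronglyMeasurable hhX.aestronglyMeasurable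
  have hae := condExp_mul_of_stronglyMeasurable_left (m := Hs) (μ := P)
    hh.stronglyMeasurable hhX hXi
  have hae2 : P[h * X | Hs] =ᵐ[P] h * p := by
    filter_upwards [hae, hXcond] with ω h1 h2
    rw [h1, Pi.mul_apply, Pi.mul_apply, h2]
  have e2 : ∫ ω, h ω * X ω ∂P = ∫ ω, h ω * p ω ∂P := by
    have := integral_condExp (μ := P) (f := h * X) hHs
    rw [integral_congr_ae hae2] at this
    exact this.symm
  have hhp : Integrable (h * p) P := (integrable_condExp (m := Hs) (f := h * X)).congr hae2
  have hchX : Integrable (fun ω => c ω * (h ω * X ω)) P :=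
    hhX.bdd_mul (c := 1) hcm.aestronglyMeasurable (by
      refine Filter.Eventually.of_forall fun ω => ?_
      simp only [hc]; split_ifs <;> simp)
  calc _ = ∫ ω, c ω * (h ω * X ω) - (𝓓 {n | n ≤ m}).toReal * (h ω * p ω) ∂P := by
        congr 1; ext ω; ring
    _ = 0 := by
        have hhp' : Integrable (fun ω => (𝓓 {n | n ≤ m}).toReal * (h ω * p ω)) P :=
          hhp.const_mul _
        rw [integral_sub hchX hhp', integral_const_mul, e1, e2, sub_self]
lemma conf {Ω : Type*} {d : ℕ} {A : ℕ → Ω → Fin d → ℝ} {X : ℕ → Ω → ℝ} {D : ℕ → Ω → ℕ}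
    {lam δ τ : ℝ} {m t : ℕ} {θ : Fin d → ℝ} {ω : Ω} (hl : 0 < lam) (ht : 1 ≤ t)
    (hθ : θ ⬝ᵥ θ ≤ 1) (hτ0 : 0 ≤ τ) (hτ1 : τ ≤ 1)
    (hX : ∀ s ∈ Finset.Ico 1 t, X s ω = 0 ∨ X s ω = 1)
    (hgood : √(Qf (fun s => A s ω) lam t
        (Sv (fun s => A s ω) (fun s => etaN A X D m τ θ s ω) t)
        (Sv (fun s => A s ω) (fun s => etaN A X D m τ θ s ω) t)) ≤
      √(2 * Real.log (1 / δ) + d * Real.log ((d * lam + t) / (d * lam))))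
    (a : Fin d → ℝ) :
    |a ⬝ᵥ thetaHatW A X D lam m t ω - τ * (a ⬝ᵥ θ)| ≤
      (fconf d lam δ t + ∑ s ∈ Finset.Ico (max 1 (t - m)) t,
        mnorm (Vmat (fun u => A u ω) lam t)⁻¹ (A s ω)) *
        mnorm (Vmat (fun u => A u ω) lam t)⁻¹ a := by
  set B : ℕ → Fin d → ℝ := fun s => A s ω with hB
  set S := Sv B (fun s => etaN A X D m τ θ s ω) t with hS
  have hmn : ∀ x, mnorm (Vmat B lam t)⁻¹ x = √(Qf B lam t x x) := fun x => rfl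
  simp only [hmn]
  have e1 : a ⬝ᵥ thetaHatW A X D lam m t ω = ∑ s ∈ Finset.Ico 1 t,
      (X s ω * (if D s ω ≤ min m (t - s) then (1 : ℝ) else 0)) * Qf B lam t a (B s) := by
    change Qf B lam t a _ = _
    rw [Qf_sum_right]
    simp only [Qf_smul_right, hB]
  have e2 : a ⬝ᵥ θ = lam * Qf B lam t a θ +
      ∑ s ∈ Finset.Ico 1 t, (B s ⬝ᵥ θ) * Qf B lam t a (B s) := by
    have : θ = (Vmat B lam t)⁻¹.mulVec ((Vmat B lam t).mulVec θ) := by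
      rw [mulVec_mulVec, Matrix.nonsing_inv_mul _ (Vmat_unit hl t), one_mulVec]
    conv_lhs => rw [this]
    change Qf B lam t a _ = _
    have hV : (Vmat B lam t).mulVec θ = lam • θ + ∑ s ∈ Finset.Ico 1 t, (B s ⬝ᵥ θ) • B s := by
      rw [Vmat, add_mulVec, smul_mulVec, one_mulVec, sum_mulVec]
      congr 1
      refine Finset.sum_congr rfl fun s _ => ?_
      rw [vecMulVec_mulVec]
      simp
    rw [hV, Qf_add_right, Qf_smul_right, Qf_sum_right]
    simp only [Qf_smul_right]
  have e3 : Qf B lam t a S = ∑ s ∈ Finset.Ico 1 t, etaN A X D m τ θ s ω * Qf B lam t a (B s) := by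
    rw [hS, Sv, Qf_sum_right]
    simp only [Qf_smul_right]
  set g : ℕ → ℝ := fun s => X s ω * ((if D s ω ≤ m then (1 : ℝ) else 0) -
    (if D s ω ≤ min m (t - s) then (1 : ℝ) else 0)) * Qf B lam t a (B s) with hg
  have e4 : a ⬝ᵥ thetaHatW A X D lam m t ω - τ * (a ⬝ᵥ θ) =
      Qf B lam t a S - τ * lam * Qf B lam t a θ - ∑ s ∈ Finset.Ico 1 t, g s := by
    rw [e1, e2, e3, mul_add, Finset.mul_sum]
    have : ∑ s ∈ Finset.Ico 1 t,
      (X s ω * (if D s ω ≤ min m (t - s) then (1 : ℝ) else 0)) * Qf B lam t a (B s)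
       = ∑ s ∈ Finset.Ico 1 t, (etaN A X D m τ θ s ω * Qf B lam t a (B s) - g s +
          τ * ((B s ⬝ᵥ θ) * Qf B lam t a (B s))) := by
      refine Finset.sum_congr rfl fun s _ => ?_
      simp only [hg, etaN, hB]
      ring
    rw [this, Finset.sum_add_distrib, Finset.sum_sub_distrib]
    ring
  have e5 : ∑ s ∈ Finset.Ico 1 t, g s = ∑ s ∈ Finset.Ico (max 1 (t - m)) t, g s := by
    symm
    refine Finset.sum_subset (Finset.Ico_subset_Ico_left (le_max_left _ _)) ?_
    intro s hs hs'
    have : min m (t - s) = m := by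
      simp at hs hs'; omega
    simp only [hg, this, sub_self, mul_zero, zero_mul]
  have hn := Real.sqrt_nonneg (Qf B lam t a a)
  have b1 : |Qf B lam t a S| ≤ √(Qf B lam t a a) *
      √(2 * Real.log (1 / δ) + d * Real.log ((d * lam + t) / (d * lam))) :=
    (Qf_cs hl t a S).trans (mul_le_mul_of_nonneg_left hgood hn)
  have b2 : |τ * lam * Qf B lam t a θ| ≤ √(Qf B lam t a a) * √lam := by
    rw [abs_mul, abs_of_nonneg (by positivity : 0 ≤ τ * lam)]
    have h1 : √(Qf B lam t θ θ) ≤ 1 / √lam := by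
      rw [← Real.sqrt_one, ← Real.sqrt_div zero_le_one]
      apply Real.sqrt_le_sqrt
      refine (Qf_le hl ht θ).trans ?_
      gcongr
    have h2 := Qf_cs (A := B) hl t a θ
    have h3 : √lam * √lam = lam := Real.mul_self_sqrt hl.le
    have h4 : 0 < √lam := Real.sqrt_pos.2 hl
    calc τ * lam * |Qf B lam t a θ| ≤ 1 * lam * (√(Qf B lam t a a) * (1 / √lam)) := by
          gcongr
          exact h2.trans (mul_le_mul_of_nonneg_left h1 hn)
      _ = _ := by
          field_simp
          rw [pow_two, h3, mul_comm]
  have b3 : |∑ s ∈ Finset.Ico 1 t, g s| ≤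
      (∑ s ∈ Finset.Ico (max 1 (t - m)) t, √(Qf B lam t (A s ω) (A s ω))) * √(Qf B lam t a a) := by
    rw [e5, Finset.sum_mul]
    refine (Finset.abs_sum_le_sum_abs _ _).trans (Finset.sum_le_sum fun s hs => ?_)
    simp only [hg]
    rw [abs_mul, mul_comm (√_)]
    have h1 : |X s ω * ((if D s ω ≤ m then (1 : ℝ) else 0) -
      (if D s ω ≤ min m (t - s) then (1 : ℝ) else 0))| ≤ 1 := by
      rcases hX s (by simp at hs ⊢; omega) with h | h <;> rw [h] <;> split_ifs <;> simp
    calc _ ≤ 1 * |Qf B lam t a (B s)| := mul_le_mul_of_nonneg_right h1 (abs_nonneg _)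
      _ ≤ _ := by rw [one_mul]; exact Qf_cs hl t a (B s)
  rw [e4, fconf]
  have t1 := abs_sub (Qf B lam t a S - τ * lam * Qf B lam t a θ) (∑ s ∈ Finset.Ico 1 t, g s)
  have t2 := abs_sub (Qf B lam t a S) (τ * lam * Qf B lam t a θ)
  linarith

lemma double_sum (n : ℕ → ℝ) (m T : ℕ) :
    ∑ t ∈ Finset.Icc 1 T, ∑ s ∈ Finset.Ico (max 1 (t - m)) t, (n s ^ 2 + n t ^ 2) / 2 ≤
      m * ∑ t ∈ Finset.Icc 1 T, n t ^ 2 := by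
  have h1 : ∑ t ∈ Finset.Icc 1 T, ∑ s ∈ Finset.Ico (max 1 (t - m)) t, n t ^ 2 ≤
      m * ∑ t ∈ Finset.Icc 1 T, n t ^ 2 := by
    rw [Finset.mul_sum]
    refine Finset.sum_le_sum fun t _ => ?_
    rw [Finset.sum_const, nsmul_eq_mul]
    refine mul_le_mul_of_nonneg_right ?_ (sq_nonneg _)
    rw [Nat.card_Ico]
    exact_mod_cast (by omega : t - max 1 (t - m) ≤ m)
  have h2 : ∑ t ∈ Finset.Icc 1 T, ∑ s ∈ Finset.Ico (max 1 (t - m)) t, n s ^ 2 ≤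
      m * ∑ t ∈ Finset.Icc 1 T, n t ^ 2 := by
    rw [Finset.sum_comm' (t' := Finset.Icc 1 T)
      (s' := fun s => Finset.Icc (s+1) (min T (s + m))) (by
        intro x y; simp only [Finset.mem_Icc, Finset.mem_Ico]; omega), Finset.mul_sum]
    refine Finset.sum_le_sum fun t _ => ?_
    rw [Finset.sum_const, nsmul_eq_mul]
    refine mul_le_mul_of_nonneg_right ?_ (sq_nonneg _)
    rw [Nat.card_Icc]
    exact_mod_cast (by omega : min T (t + m) + 1 - (t + 1) ≤ m)
  simp only [← Finset.sum_div, Finset.sum_add_distrib]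
  linarith

lemma width_sum {d : ℕ} {A : ℕ → Fin d → ℝ} {lam δ : ℝ} {m T : ℕ} (hd : 1 ≤ d) (hl : 1 ≤ lam)
    (hA : ∀ s ∈ Finset.Icc 1 T, A s ⬝ᵥ A s ≤ 1) :
    ∑ t ∈ Finset.Icc 1 T, 2 * ((2 * fconf d lam δ t +
      ∑ s ∈ Finset.Ico (max 1 (t - m)) t, √(Qf A lam t (A s) (A s))) * √(Qf A lam t (A t) (A t))) ≤
    4 * fconf d lam δ T * √(2 * d * T * Real.log ((d * lam + T) / (d * lam))) +
      4 * m * d * Real.log ((d * lam + T) / (d * lam)) := by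
  have hl0 : 0 < lam := by linarith
  set n : ℕ → ℝ := fun t => √(Qf A lam t (A t) (A t)) with hn
  have hn0 : ∀ t, 0 ≤ n t := fun t => Real.sqrt_nonneg _
  have hnsq : ∀ t, n t ^ 2 = Qf A lam t (A t) (A t) := fun t => Real.sq_sqrt (Qf_nonneg hl0 t _)
  have hsq : ∑ t ∈ Finset.Icc 1 T, n t ^ 2 ≤ 2 * (d * Real.log ((d * lam + T) / (d * lam))) := by
    simp only [hnsq]; exact sum_Qf_le hd hl hA
  have hfm : ∀ t ∈ Finset.Icc 1 T, fconf d lam δ t ≤ fconf d lam δ T := by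
    intro t ht
    unfold fconf
    have := log_ratio_mono (d := d) hd hl0 (Finset.mem_Icc.1 ht).2
    gcongr √lam + √?_
    linarith
  have hf0 : 0 ≤ fconf d lam δ T := by unfold fconf; positivity
  have hsum : ∑ t ∈ Finset.Icc 1 T, n t ≤
      √(2 * d * T * Real.log ((d * lam + T) / (d * lam))) := by
    apply Real.le_sqrt_of_sq_le
    have := sq_sum_le_card_mul_sum_sq (s := Finset.Icc 1 T) (f := n)
    simp only [Nat.card_Icc, Nat.add_sub_cancel] at this
    refine this.trans ?_
    calc _ ≤ T * (2 * (d * Real.log ((d * lam + T) / (d * lam)))) :=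
          mul_le_mul_of_nonneg_left hsq (Nat.cast_nonneg T)
      _ = _ := by ring
  have hds := double_sum n m T
  have hmd : (m:ℝ) * ∑ t ∈ Finset.Icc 1 T, n t ^ 2 ≤
      m * (2 * (d * Real.log ((d * lam + T) / (d * lam)))) :=
    mul_le_mul_of_nonneg_left hsq (Nat.cast_nonneg m)
  have hterm : ∀ t ∈ Finset.Icc 1 T, 2 * ((2 * fconf d lam δ t +
      ∑ s ∈ Finset.Ico (max 1 (t - m)) t, √(Qf A lam t (A s) (A s))) * n t) ≤
      4 * fconf d lam δ T * n t +
        2 * ∑ s ∈ Finset.Ico (max 1 (t - m)) t, (n s ^ 2 + n t ^ 2) / 2 := by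
    intro t ht
    have h1 : fconf d lam δ t * n t ≤ fconf d lam δ T * n t :=
      mul_le_mul_of_nonneg_right (hfm t ht) (hn0 t)
    have h2 : (∑ s ∈ Finset.Ico (max 1 (t - m)) t, √(Qf A lam t (A s) (A s))) * n t ≤
        ∑ s ∈ Finset.Ico (max 1 (t - m)) t, (n s ^ 2 + n t ^ 2) / 2 := by
      rw [Finset.sum_mul]
      refine Finset.sum_le_sum fun s hs => ?_
      have h3 : √(Qf A lam t (A s) (A s)) ≤ n s := by
        apply Real.sqrt_le_sqrt
        simp at hs
        exact Qf_anti hl0 (by omega) (by omega) _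
      have h4 := mul_le_mul_of_nonneg_right h3 (hn0 t)
      nlinarith [sq_nonneg (n s - n t)]
    linarith
  refine (Finset.sum_le_sum hterm).trans ?_
  rw [Finset.sum_add_distrib, ← Finset.mul_sum, ← Finset.mul_sum]
  have := mul_le_mul_of_nonneg_left hsum (by linarith : 0 ≤ 4 * fconf d lam δ T)
  linarith
/-- Regret bound for OTFLinUCB. -/
theorem OTFLinUCB_regret_bound
    {Ω : Type*} [MeasurableSpace Ω] (P : Measure Ω) [IsProbabilityMeasure P]
    {d : ℕ} (hd : 1 ≤ d) (lam : ℝ) (hlam : 1 ≤ lam)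
    (m T : ℕ) (hm : 1 ≤ m) (hT : 1 ≤ T)
    (δ : ℝ) (hδ : δ ∈ Set.Ioo (0 : ℝ) 1)
    (θ : Fin d → ℝ) (hθ : Real.sqrt (θ ⬝ᵥ θ) ≤ 1)
    (𝓓 : Measure ℕ) [IsProbabilityMeasure 𝓓]
    (hτpos : 0 < (𝓓 {n | n ≤ m}).toReal)
    -- action sets: finite, nonempty, norms at most one, mean rewards in [0,1]
    (𝒜 : ℕ → Finset (Fin d → ℝ)) (h𝒜ne : ∀ t, (𝒜 t).Nonempty)
    (h𝒜 : ∀ t ∈ Finset.Icc 1 T, ∀ a ∈ 𝒜 t,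
      Real.sqrt (a ⬝ᵥ a) ≤ 1 ∧ a ⬝ᵥ θ ∈ Set.Icc (0 : ℝ) 1)
    (A : ℕ → Ω → Fin d → ℝ) (X : ℕ → Ω → ℝ) (D : ℕ → Ω → ℕ)
    (hAmeas : ∀ t, Measurable (A t)) (hXmeas : ∀ t, Measurable (X t))
    (hDmeas : ∀ t, Measurable (D t))
    -- rewards are {0,1}-valued and, conditionally on the past and `A_t`,
    -- Bernoulli with mean `⟨A_t, θ⟩`
    (hX01 : ∀ t ∈ Finset.Icc 1 T, ∀ᵐ ω ∂P, X t ω = 0 ∨ X t ω = 1)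
    (hXcond : ∀ t ∈ Finset.Icc 1 T,
      P[X t | hist A X D t] =ᵐ[P] fun ω => A t ω ⬝ᵥ θ)
    -- delays have law `𝓓` and are independent of the past, `A_t` and `X_t`
    (hDlaw : ∀ t ∈ Finset.Icc 1 T, Measure.map (D t) P = 𝓓)
    (hDindep : ∀ t ∈ Finset.Icc 1 T,
      Indep (MeasurableSpace.comap (D t) inferInstance)
        (hist A X D t ⊔ MeasurableSpace.comap (X t) inferInstance) P)
    -- the learner plays OTFLinUCB
    (hAmem : ∀ t ∈ Finset.Icc 1 T, ∀ ω, A t ω ∈ 𝒜 t)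
    (hUCB : ∀ t ∈ Finset.Icc 1 T, ∀ ω, ∀ a ∈ 𝒜 t,
      a ⬝ᵥ thetaHatW A X D lam m t ω +
          ucbWidth A lam δ m t ω * mnorm (Vmat (fun u => A u ω) lam t)⁻¹ a ≤
        A t ω ⬝ᵥ thetaHatW A X D lam m t ω +
          ucbWidth A lam δ m t ω * mnorm (Vmat (fun u => A u ω) lam t)⁻¹ (A t ω)) :
    P {ω | ∑ t ∈ Finset.Icc 1 T,
          ((𝒜 t).sup' (h𝒜ne t) (fun a => θ ⬝ᵥ a) - θ ⬝ᵥ A t ω) ≤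
        (4 * fconf d lam δ T / (𝓓 {n | n ≤ m}).toReal) *
            Real.sqrt (2 * d * T * Real.log ((d * lam + T) / (d * lam))) +
          (4 * m * d / (𝓓 {n | n ≤ m}).toReal) *
            Real.log ((d * lam + T) / (d * lam))} ≥
      ENNReal.ofReal (1 - 2 * δ) := by
  have hl0 : 0 < lam := by linarith
  obtain ⟨hδ0, hδ1⟩ := hδ
  set τ : ℝ := (𝓓 {n | n ≤ m}).toReal with hτ
  have hτ1 : τ ≤ 1 := by
    have : 𝓓 {n | n ≤ m} ≤ 1 := prob_le_one
    exact ENNReal.toReal_le_of_le_ofReal zero_le_one (by simpa using this)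
  have sq1 : ∀ a : Fin d → ℝ, √(a ⬝ᵥ a) ≤ 1 → a ⬝ᵥ a ≤ 1 := by
    intro a h
    simpa using (Real.sqrt_le_left zero_le_one).1 h
  have hθ1 := sq1 θ hθ
  have hA1 : ∀ ω, ∀ s ∈ Finset.Icc 1 T, A s ω ⬝ᵥ A s ω ≤ 1 := fun ω s hs =>
    sq1 _ (h𝒜 s hs _ (hAmem s hs ω)).1
  set η := etaN A X D m τ θ with hη
  have hηb : ∀ s ∈ Finset.Icc 1 T, ∀ᵐ ω ∂P, |η s ω| ≤ 1 := by
    intro s hs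
    filter_upwards [hX01 s hs] with ω hω
    obtain ⟨p0, p1⟩ := (h𝒜 s hs _ (hAmem s hs ω)).2
    have hp0 : 0 ≤ τ * (A s ω ⬝ᵥ θ) := mul_nonneg hτpos.le p0
    have hp1 : τ * (A s ω ⬝ᵥ θ) ≤ 1 := mul_le_one₀ hτ1 p0 p1
    simp only [hη, etaN]
    rw [abs_le]
    rcases hω with h | h <;> rw [h] <;> split_ifs <;> constructor <;> linarith
  set F : ℕ → MeasurableSpace Ω := fun t => hist A X D t with hF
  have hFle : ∀ t, F t ≤ ‹MeasurableSpace Ω› := hist_le hAmeas hXmeas hDmeas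
  set M : ℕ → Ω → ℝ := fun t ω => Mp (fun s => A s ω) lam (fun s => η s ω) t with hM
  set H : ℕ → Ω → ℝ := fun t ω => Hp (fun s => A s ω) lam (fun s => η s ω) t with hH
  have hηF : ∀ t, ∀ s ∈ Finset.Ico 1 t, Measurable[F t] (η s) := fun t s hs =>
    @meas_etaN _ (F t) _ _ _ _ m τ θ s (hist_As hs) (hist_Xs hs) (hist_Ds hs)
  have hMF : ∀ t, Measurable[F t] (M t) := fun t =>
    @meas_Mp _ (F t) _ _ _ _ (fun s hs => hist_As hs) (hηF t) lam
  have hHF : ∀ t, Measurable[F t] (H t) := fun t =>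
    @meas_Hp _ (F t) _ _ _ _ (fun s hs => hist_As hs) (hηF t) hist_A lam
  have hM0 : ∀ t ω, 0 ≤ M t ω := fun t ω => (Real.exp_pos _).le
  have hstep0 : ∀ t ∈ Finset.Icc 1 T, ∀ᵐ ω ∂P, M (t+1) ω ≤ M t ω * (1 + η t ω * H t ω) := by
    intro t ht
    filter_upwards [hηb t ht] with ω hω
    exact Mp_succ hl0 (Finset.mem_Icc.1 ht).1 hω
  have hH1 : ∀ t ω, |H t ω| ≤ 1 := fun t ω => (Real.abs_tanh_lt_one _).le
  have hMi : ∀ t ∈ Finset.Icc 1 T, Integrable (M t) P := by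
    intro t ht
    obtain ⟨h1, h2⟩ := Finset.mem_Icc.1 ht
    clear ht
    induction t, h1 using Nat.le_induction with
    | base =>
      refine (integrable_const (1:ℝ)).congr (Filter.Eventually.of_forall fun ω => ?_)
      simp [hM, Mp_one]
    | succ t h1 ih =>
      have ih := ih (by omega)
      refine Integrable.mono' (ih.mul_const 2)
        ((hMF (t+1)).mono (hFle _) le_rfl).aestronglyMeasurable ?_
      have htm : t ∈ Finset.Icc 1 T := by simp; omega
      filter_upwards [hηb t htm, hstep0 t htm] with ω a1 a2
      rw [Real.norm_of_nonneg (hM0 _ _)]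
      refine a2.trans (mul_le_mul_of_nonneg_left ?_ (hM0 t ω))
      have : |η t ω * H t ω| ≤ 1 := by
        rw [abs_mul]; exact mul_le_one₀ a1 (abs_nonneg _) (hH1 t ω)
      linarith [(abs_le.1 this).2]
  have hstep : ∀ t, 1 ≤ t → t < T → ∀ G, MeasurableSet[F t] G →
      ∫ ω in G, M (t+1) ω ∂P ≤ ∫ ω in G, M t ω ∂P := by
    intro t h1 h2 G hG
    have htm : t ∈ Finset.Icc 1 T := by simp; omega
    have hG' := hFle t _ hG
    set h : Ω → ℝ := G.indicator (fun ω => M t ω * H t ω) with hh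
    have hMHF : Measurable[F t] (fun ω => M t ω * H t ω) := Measurable.mul (hMF t) (hHF t)
    have hhF : Measurable[F t] h := Measurable.indicator hMHF hG
    have hMH : Integrable (fun ω => M t ω * H t ω) P :=
      (hMi t htm).mul_bdd (c := 1) ((hHF t).mono (hFle _) le_rfl).aestronglyMeasurable
        (Filter.Eventually.of_forall fun ω => hH1 t ω)
    have hhi : Integrable h P := hMH.indicator hG'
    have hz := noise_zero P (hFle t) (m := m) (hXmeas t) (hDmeas t) (hX01 t htm) (hXcond t htm)
      (hDlaw t htm) (hDindep t htm) h hhF hhi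
    have hηm : Measurable (η t) := meas_etaN m τ θ t (hAmeas t) (hXmeas t) (hDmeas t)
    have hMHη : Integrable (fun ω => M t ω * H t ω * η t ω) P :=
      hMH.mul_bdd (c := 1) hηm.aestronglyMeasurable (hηb t htm)
    have hz' : ∫ ω in G, M t ω * H t ω * η t ω ∂P = 0 := by
      rw [← integral_indicator hG', ← hz]
      congr 1
      ext ω
      by_cases hω : ω ∈ G <;> simp [hh, hω, hη, etaN, hτ]
    calc ∫ ω in G, M (t+1) ω ∂P ≤ ∫ ω in G, (M t ω + M t ω * H t ω * η t ω) ∂P := by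
          refine setIntegral_mono_ae (hMi (t+1) (by simp; omega)).integrableOn
            ((hMi t htm).add hMHη).integrableOn ?_
          filter_upwards [hstep0 t htm] with ω hω
          refine hω.trans (le_of_eq ?_)
          ring
      _ = _ := by
          rw [integral_add (hMi t htm).integrableOn hMHη.integrableOn, hz', add_zero]
  have hv := ville P F hFle (fun t ht => hist_mono ht) M T (fun t _ => hMF t) hM0 hMi
    (fun ω => Mp_one) hstep (1 / δ) (by rw [le_div_iff₀ hδ0]; linarith) hT
  set Bad : Set Ω := {ω | ∃ t ∈ Finset.Icc 1 T, 1 / δ < M t ω} with hBad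
  have hbadm : MeasurableSet Bad := by
    have : Bad = ⋃ t ∈ Finset.Icc 1 T, {ω | 1 / δ < M t ω} := by
      ext ω; simp [hBad]
    rw [this]
    refine Finset.measurableSet_biUnion _ fun t _ => ?_
    exact ((hMF t).mono (hFle _) le_rfl) measurableSet_Ioi
  have hPbad : P.real Bad ≤ δ := by
    rw [one_div, inv_mul_le_iff₀ hδ0] at hv
    linarith
  have hPgood : ENNReal.ofReal (1 - 2 * δ) ≤ P Badᶜ := by
    rw [← ofReal_measureReal (μ := P) (s := Badᶜ)]
    apply ENNReal.ofReal_le_ofReal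
    rw [probReal_compl_eq_one_sub hbadm]
    linarith
  refine ge_iff_le.2 (hPgood.trans (measure_mono_ae ?_))
  have hXall : ∀ᵐ ω ∂P, ∀ t ∈ Finset.Icc 1 T, X t ω = 0 ∨ X t ω = 1 := by
    rw [Filter.eventually_all_finset]
    exact hX01
  filter_upwards [hXall] with ω hXω
  intro hω
  replace hω : ω ∉ Bad := hω
  change _ ≤ _
  have hgood : ∀ t ∈ Finset.Icc 1 T, M t ω ≤ 1 / δ := by
    intro t ht
    by_contra hcon
    exact hω ⟨t, ht, not_le.1 hcon⟩
  have hr : ∀ t ∈ Finset.Icc 1 T,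
      τ * ((𝒜 t).sup' (h𝒜ne t) (fun a => θ ⬝ᵥ a) - θ ⬝ᵥ A t ω) ≤
      2 * ((2 * fconf d lam δ t + ∑ s ∈ Finset.Ico (max 1 (t - m)) t,
        √(Qf (fun s => A s ω) lam t (A s ω) (A s ω))) *
          √(Qf (fun s => A s ω) lam t (A t ω) (A t ω))) := by
    intro t ht
    obtain ⟨ht1, htT⟩ := Finset.mem_Icc.1 ht
    have hq : Qf (fun s => A s ω) lam t (Sv (fun s => A s ω) (fun s => η s ω) t)
        (Sv (fun s => A s ω) (fun s => η s ω) t) ≤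
        2 * Real.log (1 / δ) + d * Real.log ((d * lam + t) / (d * lam)) := by
      have h1 := hgood t ht
      simp only [hM, Mp] at h1
      rw [← Real.le_log_iff_exp_le (by positivity)] at h1
      obtain ⟨k, rfl⟩ : ∃ k, t = k + 1 := ⟨t - 1, by omega⟩
      have h2 := log_det_le (A := fun s => A s ω) (t := k) hd hl0
        (fun s hs => hA1 ω s (by simp at hs ⊢; omega))
      have h3 := log_ratio_mono (d := d) (lam := lam) hd hl0 (Nat.le_succ k)
      linarith
    have hc := conf (A := A) (X := X) (D := D) (lam := lam) (δ := δ) (τ := τ) (m := m) (t := t)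
      (θ := θ) (ω := ω) hl0 ht1 hθ1 hτpos.le hτ1
      (fun s hs => hXω s (by simp at hs ⊢; omega)) (Real.sqrt_le_sqrt hq)
    obtain ⟨a, ha, hae⟩ := Finset.exists_mem_eq_sup' (h𝒜ne t) (fun a => θ ⬝ᵥ a)
    rw [hae]
    have hu := hUCB t ht ω a ha
    have c1 := (abs_le.1 (hc a)).1
    have c2 := (abs_le.1 (hc (A t ω))).2
    unfold ucbWidth at hu
    rw [dotProduct_comm θ, dotProduct_comm θ]
    have hmn : ∀ x, mnorm (Vmat (fun u => A u ω) lam t)⁻¹ x = √(Qf (fun s => A s ω) lam t x x) :=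
      fun x => rfl
    simp only [hmn] at hu c1 c2
    have hf0 : 0 ≤ fconf d lam δ t := by unfold fconf; positivity
    have n1 := mul_nonneg hf0 (Real.sqrt_nonneg (Qf (fun s => A s ω) lam t a a))
    have n2 := mul_nonneg hf0 (Real.sqrt_nonneg (Qf (fun s => A s ω) lam t (A t ω) (A t ω)))
    linarith
  have hw := width_sum (A := fun s => A s ω) (δ := δ) (m := m) (T := T) hd hlam (hA1 ω)
  have hfin := (Finset.sum_le_sum hr).trans hw
  rw [← Finset.mul_sum] at hfin
  refine (le_div_iff₀' hτpos).2 hfin |>.trans (le_of_eq ?_)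
  rw [add_div]
  ring
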